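/- Let b = 10^9000, m = 10^7000, and let K₂ = { x ∈ [0,1] : x = Σ_{i≥1} d_i b^{−i} for some sequence of integers d_i with 0 ≤ d_i ≤ m − 1 }. Let K = K₂ × K₂ ⊆ [0,1]². Then for every circle S = { y ∈ ℝ² : |y − z| = r } (with z ∈ ℝ², r > 0) there exists a constant C > 0 such that for every δ ∈ (0,1), the set S^δ ∩ K can be covered by C·δ^{−5/9} closed balls of radius δ. In particular, the upper box dimension of S ∩ K is at most 5/9 = 14/9 − (2 − 1). -/

import Mathlib

open MeasureTheory Metric Filter Set
open scoped ENNReal NNReal Real Topology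

noncomputable section

/-- The missing digits set in base `p` with digit set `{0,…,m-1}`:
numbers in `[0,1]` of the form `Σ_{i≥1} dᵢ p^{-i}` with all digits `dᵢ < m`. -/
def MDset (p m : ℕ) : Set ℝ :=
  {x | x ∈ Set.Icc (0 : ℝ) 1 ∧
    ∃ d : ℕ → ℕ, (∀ i, d i < m) ∧ x = ∑' i : ℕ, (d i : ℝ) / (p : ℝ) ^ (i + 1)}

/-- The minimal number of closed `δ`-balls needed to cover `F` (0 if no finite cover exists). -/
def coverNum {X : Type*} [PseudoMetricSpace X] (F : Set X) (δ : ℝ) : ℕ :=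
  sInf {N : ℕ | ∃ S : Finset X, S.card = N ∧ F ⊆ ⋃ x ∈ S, Metric.closedBall x δ}

/-- The upper box dimension, `limsup_{δ→0⁺} log N_δ(F) / log (1/δ)`. -/
def upperBoxDim {X : Type*} [PseudoMetricSpace X] (F : Set X) : ℝ :=
  Filter.limsup (fun δ : ℝ => Real.log (coverNum F δ) / Real.log (1 / δ))
    (nhdsWithin 0 (Set.Ioi (0 : ℝ)))


def ee (u : ℝ) : ℂ := Complex.exp ((2 * π * u : ℝ) * Complex.I)

lemma ee_add (u v : ℝ) : ee (u + v) = ee u * ee v := by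
  unfold ee; rw [← Complex.exp_add]; congr 1; push_cast; ring

lemma ee_zero : ee 0 = 1 := by simp [ee]

lemma norm_ee (u : ℝ) : ‖ee u‖ = 1 := Complex.norm_exp_ofReal_mul_I _

lemma ee_conj (u : ℝ) : (starRingEnd ℂ) (ee u) = ee (-u) := by
  unfold ee; rw [← Complex.exp_conj]; congr 1
  rw [map_mul, Complex.conj_ofReal, Complex.conj_I]; push_cast; ring

lemma ee_nat (n : ℕ) : ee n = 1 := by
  unfold ee; rw [Complex.exp_eq_one_iff]; exact ⟨n, by push_cast; ring⟩

lemma ee_nat_mul (n : ℕ) (u : ℝ) : ee (n * u) = ee u ^ n := by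
  unfold ee; rw [← Complex.exp_nat_mul]; congr 1; push_cast; ring

lemma ee_re (u : ℝ) : (ee u).re = Real.cos (2 * π * u) := by
  unfold ee; rw [Complex.exp_ofReal_mul_I_re]

lemma ee_continuous : Continuous ee := by unfold ee; fun_prop

def Dm (m : ℕ) (u : ℝ) : ℂ := ∑ d ∈ Finset.range m, ee (d * u)

def dn (m : ℕ) (u : ℝ) : ℝ := ‖Dm m u‖ / m

lemma norm_Dm_le (m : ℕ) (u : ℝ) : ‖Dm m u‖ ≤ m := by
  unfold Dm
  refine (norm_sum_le _ _).trans ?_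
  simp [norm_ee]

lemma dn_nonneg (m : ℕ) (u : ℝ) : 0 ≤ dn m u := by unfold dn; positivity

lemma dn_le_one (m : ℕ) (u : ℝ) : dn m u ≤ 1 := by
  unfold dn; exact div_le_one_of_le₀ (norm_Dm_le m u) (by positivity)

lemma Dm_add_nat (m : ℕ) (u : ℝ) (n : ℕ) : Dm m (u + n) = Dm m u := by
  unfold Dm
  refine Finset.sum_congr rfl fun d _ => ?_
  rw [mul_add, ee_add]
  have := ee_nat (d * n)
  push_cast at this
  rw [this, mul_one]

lemma Dm_neg (m : ℕ) (u : ℝ) : ‖Dm m (-u)‖ = ‖Dm m u‖ := by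
  have : Dm m (-u) = (starRingEnd ℂ) (Dm m u) := by
    unfold Dm
    rw [map_sum]
    refine Finset.sum_congr rfl fun d _ => ?_
    rw [ee_conj]; congr 1; ring
  rw [this, Complex.norm_conj]

lemma norm_one_sub_ee (u : ℝ) : ‖ee u - 1‖ = 2 * |Real.sin (π * u)| := by
  unfold ee
  rw [mul_comm _ Complex.I, Complex.norm_exp_I_mul_ofReal_sub_one]
  rw [norm_mul, Real.norm_eq_abs, Real.norm_eq_abs, abs_two]
  congr 3; ring

lemma norm_Dm_le' (m : ℕ) (u : ℝ) (h0 : 0 < u) (h1 : u < 1) :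
    ‖Dm m u‖ ≤ 1 / 2 * (1 / u + 1 / (1 - u)) := by
  have key : ‖Dm m u‖ * ‖ee u - 1‖ ≤ 2 := by
    rw [← norm_mul]
    have : Dm m u * (ee u - 1) = ee u ^ m - 1 := by
      unfold Dm; simp_rw [ee_nat_mul]; rw [geom_sum_mul]
    rw [this]
    refine (norm_sub_le _ _).trans ?_
    rw [norm_pow, norm_ee]; norm_num
  rw [norm_one_sub_ee] at key
  have hpi := Real.pi_pos
  have h1u : 0 < 1 - u := by linarith
  rcases le_total u (1/2) with h | h
  · have hs : 2 * u ≤ Real.sin (π * u) := by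
      have := Real.mul_le_sin (x := π * u) (by positivity) (by nlinarith)
      refine le_trans (le_of_eq ?_) this
      field_simp
    have hs' := hs.trans (le_abs_self _)
    have : ‖Dm m u‖ * (2 * u) ≤ 1 := by
      nlinarith [mul_le_mul_of_nonneg_left hs' (norm_nonneg (Dm m u))]
    have h3 : ‖Dm m u‖ ≤ 1 / 2 * (1 / u) := by
      rw [show 1 / 2 * (1 / u) = 1 / (2 * u) by field_simp, le_div_iff₀ (by positivity)]
      linarith
    have : 0 < 1 / (1 - u) := by positivity
    linarith
  · have hs : 2 * (1 - u) ≤ Real.sin (π * u) := by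
      have := Real.mul_le_sin (x := π * (1 - u)) (by positivity) (by nlinarith)
      have e : Real.sin (π * (1 - u)) = Real.sin (π * u) := by
        rw [mul_sub, mul_one, Real.sin_pi_sub]
      rw [e] at this
      refine le_trans (le_of_eq ?_) this
      field_simp
    have hs' := hs.trans (le_abs_self _)
    have : ‖Dm m u‖ * (2 * (1 - u)) ≤ 1 := by
      nlinarith [mul_le_mul_of_nonneg_left hs' (norm_nonneg (Dm m u))]
    have h3 : ‖Dm m u‖ ≤ 1 / 2 * (1 / (1 - u)) := by
      rw [show 1 / 2 * (1 / (1 - u)) = 1 / (2 * (1 - u)) by field_simp, le_div_iff₀ (by positivity)]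
      linarith
    have : 0 < 1 / u := by positivity
    linarith

def hh (b m r : ℕ) : ℝ := if r = 0 then 1 else (b : ℝ) / (2 * m * r)

lemma hh_nonneg (b m r : ℕ) : 0 ≤ hh b m r := by
  unfold hh; split_ifs <;> positivity

lemma dn_le_hh (b m r : ℕ) (hm : 1 ≤ m) (hr : r < b) (t : ℝ) (ht0 : 0 ≤ t)
    (ht : t < 1 / b) : dn m (t + r / b) ≤ hh b m r + hh b m (b - 1 - r) := by
  by_cases h0 : r = 0
  · have := hh_nonneg b m (b - 1 - r)
    have h2 : hh b m r = 1 := by simp [hh, h0]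
    linarith [dn_le_one m (t + r / b)]
  by_cases h1 : b - 1 - r = 0
  · have := hh_nonneg b m r
    have h2 : hh b m (b - 1 - r) = 1 := by simp [hh, h1]
    linarith [dn_le_one m (t + r / b)]
  obtain ⟨s, hs⟩ : ∃ s, s = b - 1 - r := ⟨_, rfl⟩
  rw [← hs] at h1 ⊢
  have hb : (b : ℝ) = s + 1 + r := by exact_mod_cast (by omega : b = s + 1 + r)
  have hsp : (0 : ℝ) < s := by positivity
  have hrp : (0 : ℝ) < r := by positivity
  have hbp : (0 : ℝ) < b := by rw [hb]; positivity
  have hmp : (0 : ℝ) < m := by positivity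
  have hu1 : (r : ℝ) / b ≤ t + r / b := by linarith
  have hu2 : (s : ℝ) / b ≤ 1 - (t + r / b) := by
    have : (s : ℝ) / b = 1 - (1 / b + r / b) := by
      field_simp; linarith
    linarith
  have hrb : 0 < (r : ℝ) / b := by positivity
  have hsb : 0 < (s : ℝ) / b := by positivity
  have := norm_Dm_le' m (t + r / b) (by linarith) (by linarith)
  have i1 : 1 / (t + r / b) ≤ b / r := by
    have := one_div_le_one_div_of_le hrb hu1
    simpa using this
  have i2 : 1 / (1 - (t + r / b)) ≤ b / s := by
    have := one_div_le_one_div_of_le hsb hu2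
    simpa using this
  unfold dn
  rw [div_le_iff₀ hmp]
  have e : (hh b m r + hh b m s) * m = 1 / 2 * (b / r + b / s) := by
    simp only [hh, h0, h1, if_false]
    field_simp
  rw [e]
  linarith

lemma sum_hh (b m : ℕ) (hb : 1 ≤ b) (hm : 1 ≤ m) (hmb : m ≤ b) :
    ∑ r ∈ Finset.range b, hh b m r ≤ 1 + b / (2 * m) * (1 + Real.log b) := by
  obtain ⟨c, rfl⟩ : ∃ c, b = c + 1 := ⟨b - 1, by omega⟩
  rw [Finset.sum_range_succ']
  have e0 : hh (c + 1) m 0 = 1 := by simp [hh]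
  rw [e0, add_comm]
  gcongr
  have : ∑ k ∈ Finset.range c, hh (c + 1) m (k + 1) =
      ((c + 1 : ℕ) : ℝ) / (2 * m) * ((harmonic c : ℚ) : ℝ) := by
    unfold harmonic
    push_cast
    rw [Finset.mul_sum]
    refine Finset.sum_congr rfl fun k _ => ?_
    simp only [hh, Nat.succ_ne_zero, if_false]
    push_cast
    rw [← div_div, div_eq_mul_inv (_ / _)]
  rw [this]
  gcongr
  refine (harmonic_le_one_add_log c).trans ?_
  rcases Nat.eq_zero_or_pos c with rfl | h
  · simp
  gcongr
  simp

lemma sum_dn (b m : ℕ) (hb : 1 ≤ b) (hm : 1 ≤ m) (hmb : m ≤ b) (t : ℝ) (ht0 : 0 ≤ t)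
    (ht : t < 1 / b) :
    ∑ r ∈ Finset.range b, dn m (t + r / b) ≤ b / m * (3 + Real.log b) := by
  have h1 : ∑ r ∈ Finset.range b, dn m (t + r / b) ≤
      ∑ r ∈ Finset.range b, (hh b m r + hh b m (b - 1 - r)) :=
    Finset.sum_le_sum fun r hr => dn_le_hh b m r hm (Finset.mem_range.1 hr) t ht0 ht
  rw [Finset.sum_add_distrib, Finset.sum_range_reflect (fun r => hh b m r)] at h1
  have h2 := sum_hh b m hb hm hmb
  have hmp : (0 : ℝ) < m := by positivity
  have h3 : (1 : ℝ) ≤ b / m := by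
    rw [le_div_iff₀ hmp]; simpa using hmb
  have e : (b : ℝ) / (2 * m) = b / m / 2 := by field_simp
  rw [e] at h2
  linarith

def pk (m b k : ℕ) (n : ℕ) : ℝ := ∏ i ∈ Finset.range k, dn m (n / (b : ℝ) ^ (i + 1))

lemma pk_nonneg (m b k n : ℕ) : 0 ≤ pk m b k n := Finset.prod_nonneg fun _ _ => dn_nonneg _ _

lemma sum_range_mul_split (f : ℕ → ℝ) (M b : ℕ) :
    ∑ n ∈ Finset.range (M * b), f n =
      ∑ r ∈ Finset.range b, ∑ n ∈ Finset.range M, f (M * r + n) := by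
  induction b with
  | zero => simp
  | succ b ih => rw [Nat.mul_succ, Finset.sum_range_add, ih, Finset.sum_range_succ]

lemma pk_shift (m b k n r : ℕ) (hb : 1 ≤ b) : pk m b k (b ^ k * r + n) = pk m b k n := by
  unfold pk
  refine Finset.prod_congr rfl fun i hi => ?_
  have hi := Finset.mem_range.1 hi
  unfold dn
  congr 2
  have hb0 : (b : ℝ) ≠ 0 := by positivity
  have : ((b ^ k * r + n : ℕ) : ℝ) / (b : ℝ) ^ (i + 1) =
      n / (b : ℝ) ^ (i + 1) + ((b ^ (k - (i + 1)) * r : ℕ) : ℝ) := by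
    have e : b ^ k = b ^ (k - (i + 1)) * b ^ (i + 1) := by rw [← pow_add]; congr 1; omega
    rw [e]; push_cast; field_simp; ring
  rw [this, Dm_add_nat]

lemma sum_pk (b m : ℕ) (hb : 1 ≤ b) (hm : 1 ≤ m) (hmb : m ≤ b) (k : ℕ) :
    ∑ n ∈ Finset.range (b ^ k), pk m b k n ≤ (b / m * (3 + Real.log b)) ^ k := by
  have hlog : 0 ≤ Real.log b := Real.log_natCast_nonneg b
  have hb0 : (0 : ℝ) < b := by positivity
  induction k with
  | zero => simp [pk]
  | succ k ih =>
    rw [pow_succ b, sum_range_mul_split, Finset.sum_comm]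
    calc ∑ n ∈ Finset.range (b ^ k), ∑ r ∈ Finset.range b, pk m b (k + 1) (b ^ k * r + n)
        = ∑ n ∈ Finset.range (b ^ k), pk m b k n *
            ∑ r ∈ Finset.range b, dn m ((n : ℝ) / b ^ (k + 1) + r / b) := by
          refine Finset.sum_congr rfl fun n _ => ?_
          rw [Finset.mul_sum]
          refine Finset.sum_congr rfl fun r _ => ?_
          have : pk m b (k + 1) (b ^ k * r + n) = pk m b k (b ^ k * r + n) *
              dn m ((b ^ k * r + n : ℕ) / (b : ℝ) ^ (k + 1)) := by
            unfold pk; rw [Finset.prod_range_succ]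
          rw [this, pk_shift _ _ _ _ _ hb]
          congr 2
          push_cast
          rw [pow_succ]
          field_simp
          ring
      _ ≤ ∑ n ∈ Finset.range (b ^ k), pk m b k n * (b / m * (3 + Real.log b)) := by
          refine Finset.sum_le_sum fun n hn => ?_
          have hn := Finset.mem_range.1 hn
          refine mul_le_mul_of_nonneg_left ?_ (pk_nonneg _ _ _ _)
          refine sum_dn b m hb hm hmb _ (by positivity) ?_
          rw [div_lt_div_iff₀ (by positivity) hb0, pow_succ, one_mul]
          have : (n : ℝ) < b ^ k := by exact_mod_cast hn
          gcongr
      _ ≤ _ := by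
          rw [← Finset.sum_mul, pow_succ]
          gcongr

def ww (n : ℕ) : ℝ := (1 + (n : ℝ)) ^ (-(1 / 4) : ℝ)

lemma ww_pos (n : ℕ) : 0 < ww n := by unfold ww; positivity

lemma ww_le_one (n : ℕ) : ww n ≤ 1 := by
  unfold ww
  exact Real.rpow_le_one_of_one_le_of_nonpos (by simp) (by norm_num)

lemma ww_le (b β k n : ℕ) (hβ : 1 ≤ β) (hb : b = β ^ 4) (hn : b ^ k ≤ n) :
    ww n ≤ 1 / (β : ℝ) ^ k := by
  unfold ww
  have hβ0 : (0 : ℝ) < β := by positivity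
  have h1 : ((β : ℝ) ^ k) ^ (4 : ℕ) ≤ 1 + n := by
    have : ((b ^ k : ℕ) : ℝ) ≤ n := by exact_mod_cast hn
    rw [hb] at this
    push_cast at this
    rw [← pow_mul, mul_comm k, pow_mul]
    linarith
  rw [Real.rpow_neg (by positivity), one_div ((β : ℝ) ^ k)]
  refine inv_anti₀ (by positivity : (0 : ℝ) < (β : ℝ) ^ k) ?_
  have := Real.rpow_le_rpow (z := 1 / 4) (by positivity) h1 (by norm_num)
  refine le_trans (le_of_eq ?_) this
  rw [← Real.rpow_natCast _ 4, ← Real.rpow_mul (by positivity)]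
  norm_num

lemma sum_pk_ww (b m β : ℕ) (hm : 1 ≤ m) (hmb : m ≤ b) (hβ : 1 ≤ β)
    (hb : b = β ^ 4) (hB : b / m * (3 + Real.log b) < β) :
    ∃ C : ℝ, 0 < C ∧ ∀ k, ∑ n ∈ Finset.range (b ^ k), pk m b k n * ww n ≤ C := by
  have hb1 : 1 ≤ b := hm.trans hmb
  have hlog : 0 ≤ Real.log b := Real.log_natCast_nonneg b
  obtain ⟨B, hBd⟩ : ∃ B : ℝ, B = b / m * (3 + Real.log b) := ⟨_, rfl⟩
  have hB0 : 0 ≤ B := by rw [hBd]; positivity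
  have hβ0 : (0 : ℝ) < β := by positivity
  have hq0 : 0 ≤ B / β := by positivity
  have hq1 : B / β < 1 := by rw [div_lt_one hβ0, hBd]; exact hB
  have main : ∀ k, ∑ n ∈ Finset.range (b ^ k), pk m b k n * ww n ≤
      1 + ∑ i ∈ Finset.range k, B * (B / β) ^ i := by
    intro k
    induction k with
    | zero => simpa [pk] using ww_le_one 0
    | succ k ih =>
      rw [Finset.sum_range_succ _ k, ← add_assoc]
      have hle : b ^ k ≤ b ^ (k + 1) := Nat.pow_le_pow_right hb1 (by omega)
      rw [← Finset.sum_range_add_sum_Ico _ hle]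
      refine add_le_add (le_trans ?_ ih) ?_
      · refine Finset.sum_le_sum fun n _ => ?_
        refine mul_le_mul_of_nonneg_right ?_ (ww_pos n).le
        unfold pk
        rw [Finset.prod_range_succ]
        exact mul_le_of_le_one_right (pk_nonneg m b k n) (dn_le_one _ _)
      · calc ∑ n ∈ Finset.Ico (b ^ k) (b ^ (k + 1)), pk m b (k + 1) n * ww n
            ≤ ∑ n ∈ Finset.Ico (b ^ k) (b ^ (k + 1)), pk m b (k + 1) n * (1 / (β : ℝ) ^ k) := by
              refine Finset.sum_le_sum fun n hn => ?_
              refine mul_le_mul_of_nonneg_left ?_ (pk_nonneg _ _ _ _)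
              exact ww_le b β k n hβ hb (Finset.mem_Ico.1 hn).1
          _ ≤ ∑ n ∈ Finset.range (b ^ (k + 1)), pk m b (k + 1) n * (1 / (β : ℝ) ^ k) := by
              refine Finset.sum_le_sum_of_subset_of_nonneg ?_ ?_
              · intro n hn
                exact Finset.mem_range.2 (Finset.mem_Ico.1 hn).2
              · intro n _ _
                exact mul_nonneg (pk_nonneg _ _ _ _) (by positivity)
          _ ≤ B ^ (k + 1) * (1 / (β : ℝ) ^ k) := by
              rw [← Finset.sum_mul]
              have := sum_pk b m hb1 hm hmb (k + 1)
              rw [← hBd] at this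
              gcongr
          _ = _ := by rw [div_pow, pow_succ]; ring
  refine ⟨1 + B * (1 - B / β)⁻¹, ?_, fun k => (main k).trans ?_⟩
  · have : 0 < 1 - B / β := by linarith
    positivity
  · rw [← Finset.mul_sum]
    gcongr
    have hs := (hasSum_geometric_of_lt_one hq0 hq1)
    exact sum_le_hasSum _ (fun i _ => by positivity) hs

def fL (L : ℝ) (x : ℝ) : ℂ := Complex.exp ((L * Real.cos x : ℝ) * Complex.I)

lemma fL_cont (L : ℝ) : Continuous (fL L) := by unfold fL; fun_prop

lemma fL_norm (L x : ℝ) : ‖fL L x‖ = 1 := Complex.norm_exp_ofReal_mul_I _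

lemma osc_tail (L ε : ℝ) (hL : L ≠ 0) (he : 0 < ε) (he2 : ε ≤ π / 2) :
    ‖∫ x in ε..(π / 2), fL L x‖ ≤ π / (|L| * ε) := by
  have hpi := Real.pi_pos
  have hsin : ∀ x ∈ Set.uIcc ε (π / 2), 0 < Real.sin x := by
    intro x hx
    rw [Set.uIcc_of_le he2] at hx
    exact Real.sin_pos_of_pos_of_lt_pi (by linarith [hx.1]) (by linarith [hx.2])
  have hd : ∀ x ∈ Set.uIcc ε (π / 2), HasDerivAt (fun x => fL L x * ((1 / Real.sin x : ℝ) : ℂ))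
      (-(L * Complex.I) * fL L x + fL L x * ((-Real.cos x / Real.sin x ^ 2 : ℝ) : ℂ)) x := by
    intro x hx
    have hs := hsin x hx
    have h1 : HasDerivAt (fun x => fL L x) (fL L x * ((L * -Real.sin x : ℝ) * Complex.I)) x := by
      have := (((Real.hasDerivAt_cos x).const_mul L).ofReal_comp.mul_const Complex.I).cexp
      exact this
    have h2 : HasDerivAt (fun x => ((1 / Real.sin x : ℝ) : ℂ))
        ((-Real.cos x / Real.sin x ^ 2 : ℝ) : ℂ) x := by
      have := ((Real.hasDerivAt_sin x).inv hs.ne').ofReal_comp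
      simpa [one_div] using this
    refine (h1.mul h2).congr_deriv ?_
    have : (Real.sin x : ℂ) ≠ 0 := by exact_mod_cast hs.ne'
    rw [Complex.ofReal_mul, Complex.ofReal_neg, Complex.ofReal_div 1, Complex.ofReal_one]
    field_simp
    try ring
  have hcA : ContinuousOn (fun x => -(L * Complex.I) * fL L x) (Set.uIcc ε (π / 2)) :=
    (continuous_const.mul (fL_cont L)).continuousOn
  have hcr : ContinuousOn (fun x => -Real.cos x / Real.sin x ^ 2) (Set.uIcc ε (π / 2)) := by
    refine ContinuousOn.div (by fun_prop) (by fun_prop) ?_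
    intro x hx
    have := hsin x hx
    positivity
  have hcB : ContinuousOn (fun x => fL L x * ((-Real.cos x / Real.sin x ^ 2 : ℝ) : ℂ))
      (Set.uIcc ε (π / 2)) :=
    (fL_cont L).continuousOn.mul (Complex.continuous_ofReal.comp_continuousOn hcr)
  have ftc := intervalIntegral.integral_eq_sub_of_hasDerivAt hd
    (hcA.add hcB).intervalIntegrable
  rw [intervalIntegral.integral_add hcA.intervalIntegrable hcB.intervalIntegrable,
    intervalIntegral.integral_const_mul] at ftc
  have hd2 : ∀ x ∈ Set.uIcc ε (π / 2), HasDerivAt (fun x => 1 / Real.sin x)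
      (-Real.cos x / Real.sin x ^ 2) x := by
    intro x hx
    have := (Real.hasDerivAt_sin x).inv (hsin x hx).ne'
    simp only [one_div]
    exact this
  have ftc2 := intervalIntegral.integral_eq_sub_of_hasDerivAt hd2 hcr.intervalIntegrable
  have hBn : ‖∫ x in ε..(π / 2), fL L x * ((-Real.cos x / Real.sin x ^ 2 : ℝ) : ℂ)‖ ≤
      1 / Real.sin ε - 1 := by
    refine (intervalIntegral.norm_integral_le_integral_norm he2).trans ?_
    have : ∫ x in ε..(π / 2), ‖fL L x * ((-Real.cos x / Real.sin x ^ 2 : ℝ) : ℂ)‖ =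
        ∫ x in ε..(π / 2), -(-Real.cos x / Real.sin x ^ 2) := by
      refine intervalIntegral.integral_congr fun x hx => ?_
      have hs := hsin x hx
      rw [Set.uIcc_of_le he2] at hx
      have hc : 0 ≤ Real.cos x :=
        Real.cos_nonneg_of_neg_pi_div_two_le_of_le (by linarith [hx.1]) hx.2
      simp only [norm_mul, fL_norm, one_mul, Complex.norm_real, Real.norm_eq_abs]
      rw [abs_of_nonpos]
      rw [neg_div]
      have : 0 ≤ Real.cos x / Real.sin x ^ 2 := by positivity
      linarith
    rw [this, intervalIntegral.integral_neg, ftc2]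
    simp
  have hse : 0 < Real.sin ε := hsin ε Set.left_mem_uIcc
  have hsj : 2 / π * ε ≤ Real.sin ε := Real.mul_le_sin he.le he2
  set J := ∫ x in ε..(π / 2), fL L x
  have hn : |L| * ‖J‖ ≤ 2 / Real.sin ε := by
    have e : (-(L * Complex.I)) * J = fL L (π / 2) * ((1 / Real.sin (π / 2) : ℝ) : ℂ) -
        fL L ε * ((1 / Real.sin ε : ℝ) : ℂ) -
        ∫ x in ε..(π / 2), fL L x * ((-Real.cos x / Real.sin x ^ 2 : ℝ) : ℂ) := by
      rw [← ftc]; ring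
    have e2 : |L| * ‖J‖ = ‖(-(L * Complex.I)) * J‖ := by simp
    rw [e2, e]
    refine (norm_sub_le _ _).trans ((add_le_add (norm_sub_le _ _) hBn).trans ?_)
    simp only [norm_mul, fL_norm, one_mul, Complex.norm_real, Real.norm_eq_abs]
    rw [Real.sin_pi_div_two, abs_of_pos (by positivity : 0 < 1 / Real.sin ε)]
    norm_num
    rw [div_eq_mul_inv 2]
    linarith
  have hL' : 0 < |L| := abs_pos.2 hL
  rw [le_div_iff₀ (by positivity)]
  have h5 : 2 / Real.sin ε ≤ π / ε := by
    rw [div_le_div_iff₀ hse he]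
    have : 2 * ε = π * (2 / π * ε) := by field_simp
    rw [this]; gcongr
  have h6 := hn.trans h5
  rw [le_div_iff₀ he] at h6
  linarith

lemma osc_quarter (L : ℝ) (hL : L ≠ 0) :
    ‖∫ x in (0 : ℝ)..(π / 2), fL L x‖ ≤ 5 / √|L| := by
  have hL' : 0 < |L| := abs_pos.2 hL
  have hs : 0 < √|L| := Real.sqrt_pos.2 hL'
  have hpi := Real.pi_pos
  have hpi4 := Real.pi_lt_four
  have hpi3 := Real.pi_gt_three
  have triv : ∀ a b : ℝ, ‖∫ x in a..b, fL L x‖ ≤ |b - a| := by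
    intro a b
    have := intervalIntegral.norm_integral_le_of_norm_le_const (C := 1) (a := a) (b := b)
      (f := fL L) (fun x _ => (fL_norm L x).le)
    simpa using this
  rcases le_total 1 (√|L|) with h | h
  · have he1 : 1 / √|L| ≤ 1 := by rw [div_le_one hs]; exact h
    have he0 : 0 < 1 / √|L| := by positivity
    rw [← intervalIntegral.integral_add_adjacent_intervals (b := 1 / √|L|)
      ((fL_cont L).intervalIntegrable _ _) ((fL_cont L).intervalIntegrable _ _)]
    refine (norm_add_le _ _).trans ?_
    have t1 := triv 0 (1 / √|L|)
    rw [sub_zero, abs_of_pos he0] at t1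
    have t2 := osc_tail L (1 / √|L|) hL he0 (by linarith)
    have e : π / (|L| * (1 / √|L|)) = π / √|L| := by
      congr 1
      rw [mul_one_div, Real.div_sqrt]
    rw [e] at t2
    have : 5 / √|L| = 1 / √|L| + 4 / √|L| := by ring
    have : π / √|L| ≤ 4 / √|L| := by gcongr
    linarith
  · have t1 := triv 0 (π / 2)
    rw [sub_zero, abs_of_pos (by positivity)] at t1
    have : 5 ≤ 5 / √|L| := by
      rw [le_div_iff₀ hs]; linarith
    linarith

lemma osc_full (L : ℝ) (hL : L ≠ 0) :
    ‖∫ x in (0 : ℝ)..(2 * π), fL L x‖ ≤ 20 / √|L| := by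
  have hi : ∀ M a b : ℝ, IntervalIntegrable (fL M) volume a b :=
    fun M a b => (fL_cont M).intervalIntegrable _ _
  have half : ∀ M : ℝ, M ≠ 0 → ‖∫ x in (0 : ℝ)..π, fL M x‖ ≤ 10 / √|M| := by
    intro M hM
    rw [← intervalIntegral.integral_add_adjacent_intervals (hi M 0 (π / 2)) (hi M (π / 2) π)]
    have e : ∫ x in (π / 2)..π, fL M x = ∫ x in (0 : ℝ)..(π / 2), fL (-M) x := by
      have := intervalIntegral.integral_comp_sub_left (a := 0) (b := π / 2) (fun x => fL M x) π
      rw [sub_zero, show π - π / 2 = π / 2 by ring] at this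
      rw [← this]
      refine intervalIntegral.integral_congr fun x _ => ?_
      simp [fL, Real.cos_pi_sub]
    rw [e]
    refine (norm_add_le _ _).trans ?_
    have h1 := osc_quarter M hM
    have h2 := osc_quarter (-M) (neg_ne_zero.2 hM)
    rw [abs_neg] at h2
    have : 10 / √|M| = 5 / √|M| + 5 / √|M| := by ring
    linarith
  rw [← intervalIntegral.integral_add_adjacent_intervals (hi L 0 π) (hi L π (2 * π))]
  have e : ∫ x in π..(2 * π), fL L x = ∫ x in (0 : ℝ)..π, fL L x := by
    have := intervalIntegral.integral_comp_sub_left (a := 0) (b := π) (fun x => fL L x) (2 * π)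
    rw [sub_zero, show 2 * π - π = π by ring] at this
    rw [← this]
    refine intervalIntegral.integral_congr fun x _ => ?_
    simp [fL, Real.cos_two_pi_sub]
  rw [e]
  refine (norm_add_le _ _).trans ?_
  have h1 := half L hL
  have : 20 / √|L| = 10 / √|L| + 10 / √|L| := by ring
  linarith

lemma osc_circle (A B : ℝ) (h : A ^ 2 + B ^ 2 ≠ 0) :
    ‖∫ x in (0 : ℝ)..(2 * π), Complex.exp ((A * Real.cos x + B * Real.sin x : ℝ) * Complex.I)‖ ≤
      20 / √(√(A ^ 2 + B ^ 2)) := by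
  obtain ⟨ρ, hρ⟩ : ∃ ρ, ρ = √(A ^ 2 + B ^ 2) := ⟨_, rfl⟩
  have hρ0 : 0 < ρ := by rw [hρ]; exact Real.sqrt_pos.2 (lt_of_le_of_ne (by positivity) h.symm)
  obtain ⟨α, hα⟩ : ∃ α, α = Complex.arg ⟨A, B⟩ := ⟨_, rfl⟩
  have hn : ‖(⟨A, B⟩ : ℂ)‖ = ρ := by
    rw [hρ, Complex.norm_def, Complex.normSq_mk]; congr 1; ring
  have hA : A = ρ * Real.cos α := by
    have := Complex.norm_mul_cos_arg ⟨A, B⟩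
    rw [hn, ← hα] at this; exact this.symm
  have hB : B = ρ * Real.sin α := by
    have := Complex.norm_mul_sin_arg ⟨A, B⟩
    rw [hn, ← hα] at this; exact this.symm
  have e : ∀ x, Complex.exp ((A * Real.cos x + B * Real.sin x : ℝ) * Complex.I) =
      fL ρ (x - α) := by
    intro x
    unfold fL
    congr 2
    rw [Real.cos_sub, hA, hB]; push_cast; ring
  simp_rw [e]
  rw [intervalIntegral.integral_comp_sub_right (fun x => fL ρ x)]
  have hper : Function.Periodic (fL ρ) (2 * π) := by
    intro x; simp [fL]
  have := hper.intervalIntegral_add_eq (0 - α) 0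
  rw [show 0 - α + 2 * π = 2 * π - α by ring, zero_add] at this
  rw [this, ← hρ]
  have := osc_full ρ hρ0.ne'
  rwa [abs_of_pos hρ0] at this

/-- Fourier decay on the circle, in product form. -/
lemma osc_int (r z1 z2 : ℝ) (hr : 0 < r) : ∃ C : ℝ, 0 < C ∧ ∀ n l : ℤ,
    ‖∫ x in (0 : ℝ)..(2 * π), ee (-(n * (z1 + r * Real.cos x))) *
      ee (-(l * (z2 + r * Real.sin x)))‖ ≤ C * (ww n.natAbs * ww l.natAbs) := by
  have hpi := Real.pi_pos
  refine ⟨max (2 * π) (40 / √(2 * π * r)), lt_max_of_lt_left (by positivity), fun n l => ?_⟩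
  have hw : 0 < ww n.natAbs * ww l.natAbs := mul_pos (ww_pos _) (ww_pos _)
  by_cases h0 : n = 0 ∧ l = 0
  · obtain ⟨rfl, rfl⟩ := h0
    simp [ee_zero, ww, abs_of_pos hpi]
  have e : ∀ x, ee (-(n * (z1 + r * Real.cos x))) * ee (-(l * (z2 + r * Real.sin x))) =
      ee (-(n * z1) - l * z2) * Complex.exp (((-(2 * π * r * n)) * Real.cos x +
        (-(2 * π * r * l)) * Real.sin x : ℝ) * Complex.I) := by
    intro x
    rw [← ee_add]
    unfold ee
    rw [← Complex.exp_add]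
    congr 1
    push_cast; ring
  simp_rw [e]
  rw [intervalIntegral.integral_const_mul, norm_mul, norm_ee, one_mul]
  have hnl : (1 : ℝ) ≤ (n : ℝ) ^ 2 + (l : ℝ) ^ 2 := by
    have : (1 : ℤ) ≤ n ^ 2 + l ^ 2 := by
      by_contra hc
      apply h0
      constructor <;> nlinarith [sq_nonneg n, sq_nonneg l, sq_nonneg (n-l), mul_self_nonneg n]
    exact_mod_cast this
  have e2 : (-(2 * π * r * n)) ^ 2 + (-(2 * π * r * l)) ^ 2 =
      (2 * π * r) ^ 2 * ((n : ℝ) ^ 2 + (l : ℝ) ^ 2) := by ring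
  refine (osc_circle _ _ (by rw [e2]; positivity)).trans ?_
  rw [e2, Real.sqrt_mul (by positivity), Real.sqrt_sq (by positivity), Real.sqrt_mul (by positivity)]
  refine le_trans ?_ (mul_le_mul_of_nonneg_right (le_max_right _ _) hw.le)
  have hww : ww n.natAbs * ww l.natAbs =
      ((1 + |(n : ℝ)|) * (1 + |(l : ℝ)|)) ^ (-(1 / 4) : ℝ) := by
    unfold ww
    rw [Real.mul_rpow (by positivity) (by positivity), Nat.cast_natAbs, Nat.cast_natAbs]
    push_cast; rfl
  have hle : (1 + |(n : ℝ)|) * (1 + |(l : ℝ)|) ≤ 16 * ((n : ℝ) ^ 2 + (l : ℝ) ^ 2) := by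
    have h1 := sq_abs (n : ℝ)
    have h2 := sq_abs (l : ℝ)
    nlinarith [sq_nonneg (|(n : ℝ)| - 1), sq_nonneg (|(l : ℝ)| - 1),
      sq_nonneg (|(n : ℝ)| - |(l : ℝ)|)]
  have hw2 : (16 * ((n : ℝ) ^ 2 + (l : ℝ) ^ 2)) ^ (-(1 / 4) : ℝ) ≤
      ww n.natAbs * ww l.natAbs := by
    rw [hww]
    exact Real.rpow_le_rpow_of_nonpos (by positivity) hle (by norm_num)
  refine le_trans (le_of_eq ?_) (mul_le_mul_of_nonneg_left hw2 (by positivity))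
  have h16 : (16 : ℝ) ^ (-(1 / 4) : ℝ) = 1 / 2 := by
    rw [show (16 : ℝ) = 2 ^ (4 : ℝ) by norm_num, ← Real.rpow_mul (by norm_num)]
    norm_num
  rw [Real.mul_rpow (by norm_num) (by positivity), h16, Real.rpow_neg (by positivity)]
  have : √(√((n : ℝ) ^ 2 + (l : ℝ) ^ 2)) = ((n : ℝ) ^ 2 + (l : ℝ) ^ 2) ^ (1 / 4 : ℝ) := by
    rw [Real.sqrt_eq_rpow, Real.sqrt_eq_rpow, ← Real.rpow_mul (by positivity)]
    norm_num
  rw [this]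
  field_simp
  norm_num

/-- The digit strings of length `k`. -/
def TT (m k : ℕ) : Finset (Fin k → ℕ) := Fintype.piFinset fun _ => Finset.range m

/-- The point coded by a digit string. -/
def xx (b k : ℕ) (d : Fin k → ℕ) : ℝ := ∑ i, (d i : ℝ) / (b : ℝ) ^ ((i : ℕ) + 1)

def LL (m b k : ℕ) (n : ℤ) : ℂ := ∑ d ∈ TT m k, ee (n * xx b k d)

lemma ee_sum {ι : Type*} (s : Finset ι) (f : ι → ℝ) : ee (∑ i ∈ s, f i) = ∏ i ∈ s, ee (f i) := by
  classical
  induction s using Finset.induction_on with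
  | empty => simp [ee_zero]
  | insert a s ha ih => rw [Finset.sum_insert ha, Finset.prod_insert ha, ee_add, ih]

lemma norm_LL (m b k : ℕ) (hm : 1 ≤ m) (n : ℤ) :
    ‖LL m b k n‖ = (m : ℝ) ^ k * pk m b k n.natAbs := by
  have h1 : LL m b k n = ∏ i : Fin k, Dm m (n / (b : ℝ) ^ ((i : ℕ) + 1)) := by
    unfold LL TT Dm
    rw [Finset.prod_univ_sum]
    refine Finset.sum_congr rfl fun d _ => ?_
    unfold xx
    rw [Finset.mul_sum, ee_sum]
    refine Finset.prod_congr rfl fun i _ => ?_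
    congr 1; ring
  have h2 : ∀ u : ℝ, ‖Dm m u‖ = m * dn m u := by
    intro u; unfold dn
    have : (m : ℝ) ≠ 0 := by positivity
    field_simp
  have h3 : ∀ i : ℕ, ‖Dm m (n / (b : ℝ) ^ (i + 1))‖ =
      ‖Dm m ((n.natAbs : ℝ) / (b : ℝ) ^ (i + 1))‖ := by
    intro i
    rcases Int.natAbs_eq n with h | h
    · have : (n : ℝ) = (n.natAbs : ℝ) := by
        conv_lhs => rw [h]
        simp
      rw [this]
    · have : (n : ℝ) = -(n.natAbs : ℝ) := by
        conv_lhs => rw [h]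
        simp
      rw [this, neg_div, Dm_neg]
  rw [h1, norm_prod]
  simp_rw [h3, h2]
  rw [Finset.prod_mul_distrib, Finset.prod_const, Finset.card_univ, Fintype.card_fin]
  unfold pk
  rw [Finset.prod_range (fun i => dn m ((n.natAbs : ℝ) / (b : ℝ) ^ (i + 1)))]

lemma normSq_Dm (N : ℕ) (u : ℝ) : ((‖Dm N u‖ ^ 2 : ℝ) : ℂ) =
    ∑ p ∈ Finset.range N ×ˢ Finset.range N, ee ((((p.1 : ℤ) - (p.2 : ℤ) : ℤ) : ℝ) * u) := by
  rw [Finset.sum_product]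
  push_cast
  rw [← Complex.mul_conj']
  unfold Dm
  rw [map_sum, Finset.sum_mul_sum]
  refine Finset.sum_congr rfl fun a _ => Finset.sum_congr rfl fun c _ => ?_
  rw [ee_conj, ← ee_add]
  congr 1; ring

/-- The Fejer-type sum over the digit points. -/
lemma sum_normSq (m b k N : ℕ) (X : ℝ) :
    ((∑ d ∈ TT m k, ‖Dm N (xx b k d - X)‖ ^ 2 : ℝ) : ℂ) =
    ∑ p ∈ Finset.range N ×ˢ Finset.range N,
      LL m b k ((p.1 : ℤ) - (p.2 : ℤ)) * ee (-((((p.1 : ℤ) - (p.2 : ℤ) : ℤ) : ℝ) * X)) := by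
  rw [Complex.ofReal_sum]
  simp_rw [normSq_Dm]
  rw [Finset.sum_comm]
  refine Finset.sum_congr rfl fun p _ => ?_
  unfold LL
  rw [Finset.sum_mul]
  refine Finset.sum_congr rfl fun d _ => ?_
  rw [← ee_add]
  congr 1; ring

lemma sum_diff_le (f : ℕ → ℝ) (hf : ∀ n, 0 ≤ f n) (N : ℕ) :
    ∑ p ∈ Finset.range N ×ˢ Finset.range N, f ((p.1 : ℤ) - (p.2 : ℤ)).natAbs ≤
      N * (2 * ∑ n ∈ Finset.range N, f n) := by
  rw [Finset.sum_product]
  have : ∀ a ∈ Finset.range N, ∑ c ∈ Finset.range N, f ((a : ℤ) - (c : ℤ)).natAbs ≤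
      2 * ∑ n ∈ Finset.range N, f n := by
    intro a ha
    have ha := Finset.mem_range.1 ha
    obtain ⟨M, rfl⟩ : ∃ M, N = (a + 1) + M := ⟨N - (a + 1), by omega⟩
    have mono : ∀ K, K ≤ a + 1 + M → ∑ n ∈ Finset.range K, f n ≤
        ∑ n ∈ Finset.range (a + 1 + M), f n := fun K hK =>
      Finset.sum_le_sum_of_subset_of_nonneg (Finset.range_mono hK) fun i _ _ => hf i
    rw [Finset.sum_range_add _ (a + 1) M]
    have e1 : ∑ c ∈ Finset.range (a + 1), f ((a : ℤ) - (c : ℤ)).natAbs =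
        ∑ n ∈ Finset.range (a + 1), f n := by
      rw [← Finset.sum_range_reflect f]
      refine Finset.sum_congr rfl fun c hc => ?_
      have := Finset.mem_range.1 hc
      congr 1; omega
    have e2 : ∑ c ∈ Finset.range M, f ((a : ℤ) - ((a + 1 + c : ℕ) : ℤ)).natAbs ≤
        ∑ n ∈ Finset.range (M + 1), f n := by
      rw [Finset.sum_range_succ']
      have : ∑ c ∈ Finset.range M, f ((a : ℤ) - ((a + 1 + c : ℕ) : ℤ)).natAbs =
        ∑ n ∈ Finset.range M, f (n + 1) := by
        refine Finset.sum_congr rfl fun c hc => ?_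
        congr 1; omega
      rw [this]
      linarith [hf 0]
    have h1 := mono (a + 1) (by omega)
    have h2 := mono (M + 1) (by omega)
    rw [e1]
    linarith
  refine (Finset.sum_le_sum this).trans ?_
  simp

lemma Dm_lower (N : ℕ) (u : ℝ) (h : ∀ n < N, 2 * π * (n * |u|) ≤ 1) :
    (N : ℝ) / 2 ≤ ‖Dm N u‖ := by
  refine le_trans ?_ (Complex.re_le_norm _)
  unfold Dm
  rw [Complex.re_sum]
  have : ∀ n ∈ Finset.range N, (1 : ℝ) / 2 ≤ (ee (n * u)).re := by
    intro n hn
    rw [ee_re]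
    have h1 := Real.one_sub_sq_div_two_le_cos (x := 2 * π * (n * u))
    have h2 := h n (Finset.mem_range.1 hn)
    have h3 : |2 * π * (n * u)| ≤ 1 := by
      rw [abs_mul, abs_of_pos (by positivity : 0 < 2 * π), abs_mul, abs_of_nonneg (by positivity : (0 : ℝ) ≤ n)]
      exact h2
    have h4 : (2 * π * (n * u)) ^ 2 ≤ 1 := by
      rw [← sq_abs]; exact pow_le_one₀ (abs_nonneg _) h3
    linarith
  have := Finset.sum_le_sum this
  simp at this
  simp
  linarith

/-- The upper bound for the smoothed count. -/
lemma upper_count (m b : ℕ) (hm : 1 ≤ m) (r z1 z2 : ℝ) (hr : 0 < r) (C1 : ℝ)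
    (hC1 : ∀ k, ∑ n ∈ Finset.range (b ^ k), pk m b k n * ww n ≤ C1) :
    ∃ C : ℝ, 0 < C ∧ ∀ k N : ℕ, N ≤ b ^ k →
      ∫ x in (0 : ℝ)..(2 * π),
        (∑ d ∈ TT m k, ‖Dm N (xx b k d - (z1 + r * Real.cos x))‖ ^ 2) *
        (∑ d ∈ TT m k, ‖Dm N (xx b k d - (z2 + r * Real.sin x))‖ ^ 2) ≤
      C * ((m : ℝ) ^ k * N) ^ 2 := by
  obtain ⟨C, hC, hosc⟩ := osc_int r z1 z2 hr
  refine ⟨C * (2 * C1) ^ 2 + 1, by positivity, fun k N hN => ?_⟩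
  set P := Finset.range N ×ˢ Finset.range N with hP
  let dd : ℕ × ℕ → ℤ := fun p => (p.1 : ℤ) - (p.2 : ℤ)
  set I := ∫ x in (0 : ℝ)..(2 * π),
        (∑ d ∈ TT m k, ‖Dm N (xx b k d - (z1 + r * Real.cos x))‖ ^ 2) *
        (∑ d ∈ TT m k, ‖Dm N (xx b k d - (z2 + r * Real.sin x))‖ ^ 2) with hI
  have e1 : (I : ℂ) = ∑ p ∈ P, ∑ q ∈ P, LL m b k (dd p) * LL m b k (dd q) *
      ∫ x in (0 : ℝ)..(2 * π), ee (-((dd p : ℝ) * (z1 + r * Real.cos x))) *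
        ee (-((dd q : ℝ) * (z2 + r * Real.sin x))) := by
    rw [hI, ← intervalIntegral.integral_ofReal]
    have e2 : ∀ x : ℝ, (((∑ d ∈ TT m k, ‖Dm N (xx b k d - (z1 + r * Real.cos x))‖ ^ 2) *
        (∑ d ∈ TT m k, ‖Dm N (xx b k d - (z2 + r * Real.sin x))‖ ^ 2) : ℝ) : ℂ) =
        ∑ p ∈ P, ∑ q ∈ P, LL m b k (dd p) * LL m b k (dd q) *
          (ee (-((dd p : ℝ) * (z1 + r * Real.cos x))) *
          ee (-((dd q : ℝ) * (z2 + r * Real.sin x)))) := by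
      intro x
      rw [Complex.ofReal_mul, sum_normSq, sum_normSq, Finset.sum_mul_sum]
      refine Finset.sum_congr rfl fun p _ => Finset.sum_congr rfl fun q _ => ?_
      simp only [dd]
      ring
    simp_rw [e2]
    have hc : ∀ p q, Continuous fun x : ℝ => LL m b k (dd p) * LL m b k (dd q) *
          (ee (-((dd p : ℝ) * (z1 + r * Real.cos x))) *
          ee (-((dd q : ℝ) * (z2 + r * Real.sin x)))) := by
      intro p q
      have h1 : Continuous fun x : ℝ => ee (-((dd p : ℝ) * (z1 + r * Real.cos x))) :=
        ee_continuous.comp (by fun_prop)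
      have h2 : Continuous fun x : ℝ => ee (-((dd q : ℝ) * (z2 + r * Real.sin x))) :=
        ee_continuous.comp (by fun_prop)
      exact continuous_const.mul (h1.mul h2)
    rw [intervalIntegral.integral_finsetSum]
    · refine Finset.sum_congr rfl fun p _ => ?_
      rw [intervalIntegral.integral_finsetSum]
      · refine Finset.sum_congr rfl fun q _ => ?_
        rw [intervalIntegral.integral_const_mul]
      · intro q _
        exact (hc p q).intervalIntegrable _ _
    · intro p _
      exact (continuous_finsetSum _ fun q _ => hc p q).intervalIntegrable _ _
  have hS : ∑ p ∈ P, pk m b k (dd p).natAbs * ww (dd p).natAbs ≤ N * (2 * C1) := by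
    refine (sum_diff_le (fun n => pk m b k n * ww n)
      (fun n => mul_nonneg (pk_nonneg _ _ _ _) (ww_pos n).le) N).trans ?_
    have : ∑ n ∈ Finset.range N, pk m b k n * ww n ≤ C1 := by
      refine le_trans ?_ (hC1 k)
      exact Finset.sum_le_sum_of_subset_of_nonneg (Finset.range_mono hN)
        fun n _ _ => mul_nonneg (pk_nonneg _ _ _ _) (ww_pos n).le
    gcongr
  have hS0 : 0 ≤ ∑ p ∈ P, pk m b k (dd p).natAbs * ww (dd p).natAbs :=
    Finset.sum_nonneg fun p _ => mul_nonneg (pk_nonneg _ _ _ _) (ww_pos _).le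
  have b1 : I ≤ ‖(I : ℂ)‖ := by
    rw [Complex.norm_real]; exact le_abs_self _
  refine b1.trans ?_
  rw [e1]
  calc _ ≤ ∑ p ∈ P, ∑ q ∈ P, (C * ((m : ℝ) ^ k) ^ 2) *
        ((pk m b k (dd p).natAbs * ww (dd p).natAbs) *
          (pk m b k (dd q).natAbs * ww (dd q).natAbs)) := by
        refine (norm_sum_le _ _).trans (Finset.sum_le_sum fun p _ => ?_)
        refine (norm_sum_le _ _).trans (Finset.sum_le_sum fun q _ => ?_)
        rw [norm_mul, norm_mul, norm_LL m b k hm, norm_LL m b k hm]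
        have h1 := pk_nonneg m b k (dd p).natAbs
        have h2 := pk_nonneg m b k (dd q).natAbs
        refine (mul_le_mul_of_nonneg_left (hosc (dd p) (dd q)) (by positivity)).trans
          (le_of_eq (by ring))
    _ = (C * ((m : ℝ) ^ k) ^ 2) *
        (∑ p ∈ P, pk m b k (dd p).natAbs * ww (dd p).natAbs) ^ 2 := by
        rw [sq (Finset.sum _ _), Finset.sum_mul_sum, Finset.mul_sum]
        refine Finset.sum_congr rfl fun p _ => ?_
        rw [Finset.mul_sum]
    _ ≤ (C * ((m : ℝ) ^ k) ^ 2) * (N * (2 * C1)) ^ 2 := by gcongr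
    _ ≤ _ := by
        have : 0 ≤ ((m : ℝ) ^ k * N) ^ 2 := by positivity
        nlinarith

/-- The lower bound for the smoothed count. -/
lemma lower_count (m b k N : ℕ) (r z1 z2 δ : ℝ) (hr : 0 < r) (hδ : 0 < δ) (hδ1 : δ < 1)
    (hN : ∀ n < N, 2 * π * (n * (4 * δ)) ≤ 1)
    (G : Finset ((Fin k → ℕ) × (Fin k → ℕ))) (hG : G ⊆ TT m k ×ˢ TT m k)
    (hG2 : ∀ p ∈ G, ∃ θ : ℝ, |xx b k p.1 - (z1 + r * Real.cos θ)| ≤ 2 * δ ∧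
      |xx b k p.2 - (z2 + r * Real.sin θ)| ≤ 2 * δ) :
    (G.card : ℝ) * (2 * (δ / (1 + r)) * ((N : ℝ) / 2) ^ 4) ≤
      ∫ x in (0 : ℝ)..(2 * π),
        (∑ d ∈ TT m k, ‖Dm N (xx b k d - (z1 + r * Real.cos x))‖ ^ 2) *
        (∑ d ∈ TT m k, ‖Dm N (xx b k d - (z2 + r * Real.sin x))‖ ^ 2) := by
  have hDc : Continuous (Dm N) := by
    unfold Dm
    exact continuous_finsetSum _ fun n _ => ee_continuous.comp (by fun_prop)
  let F : (Fin k → ℕ) × (Fin k → ℕ) → ℝ → ℝ := fun p x =>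
    ‖Dm N (xx b k p.1 - (z1 + r * Real.cos x))‖ ^ 2 *
      ‖Dm N (xx b k p.2 - (z2 + r * Real.sin x))‖ ^ 2
  have hFc : ∀ p, Continuous (F p) := by
    intro p
    have h1 : Continuous fun x : ℝ => Dm N (xx b k p.1 - (z1 + r * Real.cos x)) :=
      hDc.comp (by fun_prop)
    have h2 : Continuous fun x : ℝ => Dm N (xx b k p.2 - (z2 + r * Real.sin x)) :=
      hDc.comp (by fun_prop)
    exact (h1.norm.pow 2).mul (h2.norm.pow 2)
  have hF0 : ∀ p x, 0 ≤ F p x := fun p x => by simp only [F]; positivity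
  have hpi3 := Real.pi_gt_three
  have hη0 : 0 < δ / (1 + r) := by positivity
  have hη1 : δ / (1 + r) ≤ 1 := by
    rw [div_le_one (by positivity)]; linarith
  have e : (∫ x in (0 : ℝ)..(2 * π),
        (∑ d ∈ TT m k, ‖Dm N (xx b k d - (z1 + r * Real.cos x))‖ ^ 2) *
        (∑ d ∈ TT m k, ‖Dm N (xx b k d - (z2 + r * Real.sin x))‖ ^ 2)) =
      ∑ p ∈ TT m k ×ˢ TT m k, ∫ x in (0 : ℝ)..(2 * π), F p x := by
    rw [← intervalIntegral.integral_finsetSum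
      (fun p _ => (hFc p).intervalIntegrable _ _)]
    refine intervalIntegral.integral_congr fun x _ => ?_
    simp only [F]
    rw [Finset.sum_mul_sum, Finset.sum_product]
  rw [e]
  have one : ∀ p ∈ G, 2 * (δ / (1 + r)) * ((N : ℝ) / 2) ^ 4 ≤
      ∫ x in (0 : ℝ)..(2 * π), F p x := by
    intro p hp
    obtain ⟨θ, h1, h2⟩ := hG2 p hp
    set η := δ / (1 + r) with hη
    have hper : Function.Periodic (F p) (2 * π) := by
      intro x; simp [F]
    have hsh := hper.intervalIntegral_add_eq 0 (θ - π)
    rw [zero_add, show θ - π + 2 * π = θ + π by ring] at hsh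
    rw [hsh]
    have hrη : r * η ≤ δ := by
      rw [hη, mul_div_assoc', div_le_iff₀ (by positivity)]
      nlinarith
    have low : ∀ x ∈ Set.Icc (θ - η) (θ + η), ((N : ℝ) / 2) ^ 4 ≤ F p x := by
      intro x hx
      have hxθ : |θ - x| ≤ η := by rw [abs_le]; constructor <;> linarith [hx.1, hx.2]
      have hrx : r * |θ - x| ≤ δ := (mul_le_mul_of_nonneg_left hxθ hr.le).trans hrη
      have hcos : |Real.cos θ - Real.cos x| ≤ |θ - x| := Real.abs_cos_sub_cos_le θ x
      have hsin : |Real.sin θ - Real.sin x| ≤ |θ - x| := Real.abs_sin_sub_sin_le θ x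
      have g1 : |xx b k p.1 - (z1 + r * Real.cos x)| ≤ 4 * δ := by
        have : xx b k p.1 - (z1 + r * Real.cos x) = (xx b k p.1 - (z1 + r * Real.cos θ)) +
          r * (Real.cos θ - Real.cos x) := by ring
        rw [this]
        refine (abs_add_le _ _).trans ?_
        rw [abs_mul, abs_of_pos hr]
        nlinarith
      have g2 : |xx b k p.2 - (z2 + r * Real.sin x)| ≤ 4 * δ := by
        have : xx b k p.2 - (z2 + r * Real.sin x) = (xx b k p.2 - (z2 + r * Real.sin θ)) +
          r * (Real.sin θ - Real.sin x) := by ring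
        rw [this]
        refine (abs_add_le _ _).trans ?_
        rw [abs_mul, abs_of_pos hr]
        nlinarith
      have gen : ∀ u : ℝ, |u| ≤ 4 * δ → (N : ℝ) / 2 ≤ ‖Dm N u‖ := by
        intro u hu
        refine Dm_lower N u fun n hn => le_trans ?_ (hN n hn)
        have := Real.pi_pos
        gcongr
      have k1 := gen _ g1
      have k2 := gen _ g2
      simp only [F]
      calc ((N : ℝ) / 2) ^ 4 = ((N : ℝ) / 2) ^ 2 * ((N : ℝ) / 2) ^ 2 := by ring
        _ ≤ _ := by gcongr
    have hle : ∫ x in (θ - η)..(θ + η), F p x ≤ ∫ x in (θ - π)..(θ + π), F p x := by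
      refine intervalIntegral.integral_mono_interval (by linarith) (by linarith) (by linarith)
        (Filter.Eventually.of_forall fun x => hF0 p x) ((hFc p).intervalIntegrable _ _)
    refine le_trans ?_ hle
    have := intervalIntegral.integral_mono_on (μ := volume) (a := θ - η) (b := θ + η)
      (f := fun _ => ((N : ℝ) / 2) ^ 4) (g := F p) (by linarith)
      (continuous_const.intervalIntegrable _ _) ((hFc p).intervalIntegrable _ _) low
    rw [intervalIntegral.integral_const, smul_eq_mul] at this
    refine le_trans (le_of_eq ?_) this
    ring
  calc _ = ∑ p ∈ G, 2 * (δ / (1 + r)) * ((N : ℝ) / 2) ^ 4 := by simp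
    _ ≤ ∑ p ∈ G, ∫ x in (0 : ℝ)..(2 * π), F p x := Finset.sum_le_sum one
    _ ≤ _ := Finset.sum_le_sum_of_subset_of_nonneg hG fun p _ _ =>
        intervalIntegral.integral_nonneg (by positivity) fun x _ => hF0 p x

lemma tail_bound (b m : ℕ) (hb : 4 ≤ b) (hmb : m ≤ b) (d : ℕ → ℕ) (hd : ∀ i, d i < m) (k : ℕ) :
    |(∑' i : ℕ, (d i : ℝ) / (b : ℝ) ^ (i + 1)) - xx b k (fun i => d i)| ≤ 2 / (b : ℝ) ^ k := by
  have hb4 : (4 : ℝ) ≤ b := by exact_mod_cast hb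
  have hb0 : (0 : ℝ) < b := by linarith
  have hq1 : (1 : ℝ) / b < 1 := by rw [div_lt_one hb0]; linarith
  have hle : ∀ i, (d i : ℝ) / (b : ℝ) ^ (i + 1) ≤ (1 / (b : ℝ)) ^ i := by
    intro i
    have : (d i : ℝ) ≤ b := by exact_mod_cast ((hd i).le.trans hmb)
    rw [div_pow, one_pow, div_le_div_iff₀ (by positivity) (by positivity), pow_succ, one_mul,
      mul_comm]
    gcongr
  have hsg := summable_geometric_of_lt_one (by positivity : (0 : ℝ) ≤ 1 / b) hq1
  have hs : Summable fun i : ℕ => (d i : ℝ) / (b : ℝ) ^ (i + 1) :=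
    Summable.of_nonneg_of_le (fun i => by positivity) hle hsg
  have hxx : xx b k (fun i => d i) = ∑ i ∈ Finset.range k, (d i : ℝ) / (b : ℝ) ^ (i + 1) := by
    unfold xx
    rw [Finset.sum_range (fun i => (d i : ℝ) / (b : ℝ) ^ (i + 1))]
  rw [hxx, ← hs.sum_add_tsum_nat_add k, add_sub_cancel_left]
  have hs2 := (summable_nat_add_iff k).2 hs
  have hsg2 := (summable_nat_add_iff k).2 hsg
  rw [abs_of_nonneg (tsum_nonneg fun i => by positivity)]
  refine (hs2.tsum_le_tsum (fun i => hle (i + k)) hsg2).trans ?_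
  simp_rw [pow_add]
  rw [tsum_mul_right, tsum_geometric_of_lt_one (by positivity) hq1]
  rw [div_pow, one_pow, div_eq_mul_one_div 2]
  refine mul_le_mul_of_nonneg_right ?_ (by positivity)
  have : (1 : ℝ) / b ≤ 1 / 4 := one_div_le_one_div_of_le (by norm_num) hb4
  rw [inv_le_comm₀ (by linarith) (by norm_num)]
  linarith

lemma circle_param (z y : EuclideanSpace ℝ (Fin 2)) (r : ℝ) (hy : y ∈ Metric.sphere z r) :
    ∃ θ : ℝ, y 0 = z 0 + r * Real.cos θ ∧ y 1 = z 1 + r * Real.sin θ := by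
  rw [Metric.mem_sphere, EuclideanSpace.dist_eq, Fin.sum_univ_two, Real.dist_eq, Real.dist_eq,
    sq_abs, sq_abs] at hy
  have hn : ‖(⟨y 0 - z 0, y 1 - z 1⟩ : ℂ)‖ = r := by
    rw [← hy, Complex.norm_def, Complex.normSq_mk]; congr 1; ring
  refine ⟨Complex.arg ⟨y 0 - z 0, y 1 - z 1⟩, ?_, ?_⟩
  · have := Complex.norm_mul_cos_arg ⟨y 0 - z 0, y 1 - z 1⟩
    rw [hn] at this
    simp only at this
    linarith
  · have := Complex.norm_mul_sin_arg ⟨y 0 - z 0, y 1 - z 1⟩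
    rw [hn] at this
    simp only at this
    linarith

lemma coord_le (v y : EuclideanSpace ℝ (Fin 2)) (i : Fin 2) : |v i - y i| ≤ dist v y := by
  have := PiLp.norm_apply_le (v - y) i
  rw [dist_eq_norm]
  simpa using this

lemma main_cover (b m β : ℕ) (hb4 : 4 ≤ b) (hm : 1 ≤ m) (hmb : m ≤ b) (hβ : 1 ≤ β)
    (hb : b = β ^ 4) (hB : b / m * (3 + Real.log b) < β) (hmr : (m : ℝ) = (b : ℝ) ^ (7 / 9 : ℝ))
    (z : EuclideanSpace ℝ (Fin 2)) (r : ℝ) (hr : 0 < r) :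
    ∃ C : ℝ, 0 < C ∧ ∀ δ : ℝ, 0 < δ → δ < 1 →
      ∃ S : Finset (EuclideanSpace ℝ (Fin 2)),
        (S.card : ℝ) ≤ C * δ ^ (-(5 / 9 : ℝ)) ∧
        Metric.cthickening δ (Metric.sphere z r) ∩ {v | v 0 ∈ MDset b m ∧ v 1 ∈ MDset b m} ⊆
          ⋃ x ∈ S, Metric.closedBall x δ := by
  classical
  obtain ⟨C1, -, hC1⟩ := sum_pk_ww b m β hm hmb hβ hb hB
  obtain ⟨C, hC, hup⟩ := upper_count m b hm r (z 0) (z 1) hr C1 hC1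
  have hbr : (4 : ℝ) ≤ b := by exact_mod_cast hb4
  have hb0 : (0 : ℝ) < b := by linarith
  refine ⟨C * (8 * (1 + r)) * 1024 * (((b : ℝ) ^ 2) ^ (14 / 9 : ℝ)), by positivity,
    fun δ hδ hδ1 => ?_⟩
  obtain ⟨j, hj1, hj2⟩ := exists_nat_pow_near_of_lt_one hδ hδ1.le
    (by positivity : (0 : ℝ) < 1 / b) (by rw [div_lt_one hb0]; linarith)
  rw [div_pow, one_pow] at hj1 hj2
  have hj1' : 1 < δ * (b : ℝ) ^ (j + 1) := by
    rwa [div_lt_iff₀ (by positivity)] at hj1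
  have hj2' : δ * (b : ℝ) ^ j ≤ 1 := by
    rwa [le_div_iff₀ (by positivity)] at hj2
  obtain ⟨k, hk⟩ : ∃ k, k = j + 2 := ⟨_, rfl⟩
  obtain ⟨N, hNd⟩ : ∃ N, N = ⌊1 / (32 * δ)⌋₊ + 1 := ⟨_, rfl⟩
  have hbk : 2 / (b : ℝ) ^ k ≤ δ / 2 := by
    rw [div_le_div_iff₀ (by positivity) (by norm_num), hk,
      show j + 2 = (j + 1) + 1 by ring, pow_succ _ (j + 1)]
    nlinarith
  have hN1 : ∀ n < N, 2 * π * (n * (4 * δ)) ≤ 1 := by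
    intro n hn
    have h1 : n ≤ ⌊1 / (32 * δ)⌋₊ := by omega
    have h2 : (n : ℝ) ≤ 1 / (32 * δ) :=
      (Nat.cast_le.2 h1).trans (Nat.floor_le (by positivity))
    rw [le_div_iff₀ (by positivity)] at h2
    have := Real.pi_lt_four
    have := Real.pi_pos
    have h3 : 0 ≤ (n : ℝ) * δ := by positivity
    nlinarith
  have hN2 : 1 / (32 * δ) ≤ N := by
    rw [hNd]; push_cast; exact (Nat.lt_floor_add_one _).le
  have hN3 : N ≤ b ^ k := by
    have h1 : (N : ℝ) ≤ 1 / (32 * δ) + 1 := by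
      rw [hNd]; push_cast
      have := Nat.floor_le (by positivity : 0 ≤ 1 / (32 * δ))
      linarith
    have h2 : 1 / (32 * δ) ≤ (b : ℝ) ^ (j + 1) := by
      rw [div_le_iff₀ (by positivity)]; linarith
    have h3 : (1 : ℝ) ≤ (b : ℝ) ^ (j + 1) := one_le_pow₀ (by linarith)
    have : (N : ℝ) ≤ (b : ℝ) ^ k := by
      rw [hk, show j + 2 = (j + 1) + 1 by ring, pow_succ _ (j + 1)]
      nlinarith
    exact_mod_cast this
  let G : Finset ((Fin k → ℕ) × (Fin k → ℕ)) := (TT m k ×ˢ TT m k).filter fun p =>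
    ∃ θ : ℝ, |xx b k p.1 - (z 0 + r * Real.cos θ)| ≤ 2 * δ ∧
      |xx b k p.2 - (z 1 + r * Real.sin θ)| ≤ 2 * δ
  have hlow := lower_count m b k N r (z 0) (z 1) δ hr hδ hδ1 hN1 G (Finset.filter_subset _ _)
    (fun p hp => (Finset.mem_filter.1 hp).2)
  have hcount := hlow.trans (hup k N hN3)
  refine ⟨G.image fun p => !₂[xx b k p.1, xx b k p.2], ?_, ?_⟩
  · have hcard : (((G.image fun p => !₂[xx b k p.1, xx b k p.2]).card : ℕ) : ℝ) ≤ G.card := by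
      exact_mod_cast Finset.card_image_le
    refine hcard.trans ?_
    have hN0 : (0 : ℝ) < N := lt_of_lt_of_le (by positivity) hN2
    have s1 : (G.card : ℝ) * (δ * (N : ℝ) ^ 2) ≤ C * (8 * (1 + r)) * ((m : ℝ) ^ k) ^ 2 := by
      have e : (G.card : ℝ) * (2 * (δ / (1 + r)) * ((N : ℝ) / 2) ^ 4) =
          ((G.card : ℝ) * (δ * (N : ℝ) ^ 2)) * ((N : ℝ) ^ 2 / (8 * (1 + r))) := by
        field_simp; norm_num
      have e2 : C * ((m : ℝ) ^ k * N) ^ 2 = (C * (8 * (1 + r)) * ((m : ℝ) ^ k) ^ 2) *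
          ((N : ℝ) ^ 2 / (8 * (1 + r))) := by
        field_simp
      rw [e, e2] at hcount
      exact le_of_mul_le_mul_right hcount (by positivity)
    have s2 : (G.card : ℝ) ≤ C * (8 * (1 + r)) * ((m : ℝ) ^ k) ^ 2 * (1024 * δ) := by
      have h1 : 1 / (1024 * δ) ≤ δ * (N : ℝ) ^ 2 := by
        have : (1 / (32 * δ)) ^ 2 ≤ (N : ℝ) ^ 2 := by gcongr
        calc 1 / (1024 * δ) = δ * (1 / (32 * δ)) ^ 2 := by field_simp; norm_num
          _ ≤ _ := by gcongr
      have h2 := (mul_le_mul_of_nonneg_left h1 (Nat.cast_nonneg G.card)).trans s1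
      rwa [mul_one_div, div_le_iff₀ (by positivity)] at h2
    have s3 : ((m : ℝ) ^ k) ^ 2 ≤ ((b : ℝ) ^ 2) ^ (14 / 9 : ℝ) * δ ^ (-(14 / 9) : ℝ) := by
      have e : ((m : ℝ) ^ k) ^ 2 = ((b : ℝ) ^ k) ^ (14 / 9 : ℝ) := by
        rw [hmr, ← Real.rpow_natCast, ← Real.rpow_natCast, ← Real.rpow_natCast,
          ← Real.rpow_mul hb0.le, ← Real.rpow_mul hb0.le, ← Real.rpow_mul hb0.le]
        congr 1; push_cast; ring
      rw [e, Real.rpow_neg hδ.le, ← Real.inv_rpow hδ.le, ← Real.mul_rpow (by positivity) (by positivity)]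
      refine Real.rpow_le_rpow (by positivity) ?_ (by norm_num)
      rw [hk, pow_add, mul_comm]
      gcongr
      rw [← one_div, le_div_iff₀ hδ]
      linarith
    have s4 : δ ^ (-(14 / 9) : ℝ) * δ = δ ^ (-(5 / 9) : ℝ) := by
      nth_rewrite 2 [← Real.rpow_one δ]
      rw [← Real.rpow_add hδ]; norm_num
    calc (G.card : ℝ) ≤ C * (8 * (1 + r)) * ((m : ℝ) ^ k) ^ 2 * (1024 * δ) := s2
      _ ≤ C * (8 * (1 + r)) * (((b : ℝ) ^ 2) ^ (14 / 9 : ℝ) * δ ^ (-(14 / 9) : ℝ)) * (1024 * δ) := by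
          gcongr
      _ = C * (8 * (1 + r)) * 1024 * (((b : ℝ) ^ 2) ^ (14 / 9 : ℝ)) *
          (δ ^ (-(14 / 9) : ℝ) * δ) := by ring
      _ = _ := by rw [s4]
  · rintro v ⟨hv, ⟨-, d0, hd0, hx0⟩, ⟨-, d1, hd1, hx1⟩⟩
    rw [(isCompact_sphere z r).cthickening_eq_biUnion_closedBall hδ.le] at hv
    simp only [Set.mem_iUnion] at hv
    obtain ⟨y, hy, hvy⟩ := hv
    rw [Metric.mem_closedBall] at hvy
    obtain ⟨θ, ht0, ht1⟩ := circle_param z y r hy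
    have t0 := tail_bound b m hb4 hmb d0 hd0 k
    have t1 := tail_bound b m hb4 hmb d1 hd1 k
    rw [← hx0] at t0
    rw [← hx1] at t1
    have c0 := (coord_le v y 0).trans hvy
    have c1 := (coord_le v y 1).trans hvy
    rw [ht0] at c0
    rw [ht1] at c1
    have t0' := t0.trans hbk
    have t1' := t1.trans hbk
    have hmem : ((fun i : Fin k => d0 i), (fun i : Fin k => d1 i)) ∈ G := by
      refine Finset.mem_filter.2 ⟨Finset.mem_product.2 ⟨?_, ?_⟩, θ, ?_, ?_⟩
      · exact Fintype.mem_piFinset.2 fun i => Finset.mem_range.2 (hd0 i)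
      · exact Fintype.mem_piFinset.2 fun i => Finset.mem_range.2 (hd1 i)
      · rw [abs_le] at *
        constructor <;> linarith [t0'.1, t0'.2, c0.1, c0.2]
      · rw [abs_le] at *
        constructor <;> linarith [t1'.1, t1'.2, c1.1, c1.2]
    refine Set.mem_biUnion (Finset.mem_coe.2 (Finset.mem_image_of_mem _ hmem)) ?_
    rw [Metric.mem_closedBall, EuclideanSpace.dist_eq, Fin.sum_univ_two, Real.dist_eq, Real.dist_eq]
    rw [Real.sqrt_le_left hδ.le]
    have q0 := pow_le_pow_left₀ (abs_nonneg _) t0' 2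
    have q1 := pow_le_pow_left₀ (abs_nonneg _) t1' 2
    simp only [PiLp.toLp_apply, Matrix.cons_val_zero, Matrix.cons_val_one]
    nlinarith

lemma boxDim_le (F : Set (EuclideanSpace ℝ (Fin 2))) (C : ℝ) (hC : 0 < C)
    (h : ∀ δ : ℝ, 0 < δ → δ < 1 → ∃ S : Finset (EuclideanSpace ℝ (Fin 2)),
        (S.card : ℝ) ≤ C * δ ^ (-(5 / 9 : ℝ)) ∧ F ⊆ ⋃ x ∈ S, Metric.closedBall x δ) :
    upperBoxDim F ≤ 5 / 9 := by
  have hev : ∀ᶠ δ : ℝ in nhdsWithin 0 (Set.Ioi (0 : ℝ)), 0 < δ ∧ δ < 1 := by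
    filter_upwards [Ioo_mem_nhdsGT (zero_lt_one : (0 : ℝ) < 1)] with δ hδ using hδ
  have hlogt : Tendsto (fun δ : ℝ => Real.log (1 / δ)) (nhdsWithin 0 (Set.Ioi (0 : ℝ))) atTop := by
    simp_rw [one_div]
    exact Real.tendsto_log_atTop.comp tendsto_inv_nhdsGT_zero
  have hlim : Tendsto (fun δ : ℝ => Real.log (max C 1) / Real.log (1 / δ) + 5 / 9)
      (nhdsWithin 0 (Set.Ioi (0 : ℝ))) (𝓝 (5 / 9)) := by
    have := (hlogt.const_div_atTop (Real.log (max C 1))).add_const (5 / 9)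
    simpa using this
  have hle : ∀ᶠ δ : ℝ in nhdsWithin 0 (Set.Ioi (0 : ℝ)),
      Real.log (coverNum F δ) / Real.log (1 / δ) ≤
        Real.log (max C 1) / Real.log (1 / δ) + 5 / 9 := by
    filter_upwards [hev] with δ ⟨h0, h1⟩
    obtain ⟨S, hS, hF⟩ := h δ h0 h1
    have hlog : 0 < Real.log (1 / δ) := Real.log_pos (by rw [lt_div_iff₀ h0]; linarith)
    have hcov : (coverNum F δ : ℝ) ≤ max C 1 * δ ^ (-(5 / 9 : ℝ)) := by
      have h2 : coverNum F δ ≤ S.card := Nat.sInf_le ⟨S, rfl, hF⟩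
      have h3 : (coverNum F δ : ℝ) ≤ S.card := by exact_mod_cast h2
      refine h3.trans (hS.trans ?_)
      gcongr
      exact le_max_left _ _
    have hm1 : (1 : ℝ) ≤ max C 1 := le_max_right _ _
    have hlog2 : Real.log (max C 1 * δ ^ (-(5 / 9 : ℝ))) =
        Real.log (max C 1) + 5 / 9 * Real.log (1 / δ) := by
      rw [Real.log_mul (by positivity) (by positivity), Real.log_rpow h0, one_div, Real.log_inv]
      ring
    have hlogle : Real.log (coverNum F δ) ≤ Real.log (max C 1) + 5 / 9 * Real.log (1 / δ) := by
      rcases Nat.eq_zero_or_pos (coverNum F δ) with hz | hz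
      · rw [hz]
        simp only [Nat.cast_zero, Real.log_zero]
        have := Real.log_nonneg hm1
        positivity
      · rw [← hlog2]
        exact Real.log_le_log (by positivity) hcov
    rw [div_le_iff₀ hlog, add_mul, div_mul_cancel₀ _ hlog.ne']
    exact hlogle
  have hnn : ∀ᶠ δ : ℝ in nhdsWithin 0 (Set.Ioi (0 : ℝ)),
      0 ≤ Real.log (coverNum F δ) / Real.log (1 / δ) := by
    filter_upwards [hev] with δ ⟨h0, h1⟩
    have hlog : 0 < Real.log (1 / δ) := Real.log_pos (by rw [lt_div_iff₀ h0]; linarith)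
    exact div_nonneg (Real.log_natCast_nonneg _) hlog.le
  unfold upperBoxDim
  rw [← hlim.limsup_eq]
  exact limsup_le_limsup hle (isCoboundedUnder_le_of_eventually_le _ hnn) hlim.isBoundedUnder_le

lemma params (t : ℕ) (ht2 : 2 ≤ t) (ht : 3 + 36 * Real.log t < t) (b m : ℕ) (hb : b = t ^ 36)
    (hm : m = t ^ 28) : 4 ≤ b ∧ 1 ≤ m ∧ m ≤ b ∧ 1 ≤ t ^ 9 ∧ b = (t ^ 9) ^ 4 ∧
      b / m * (3 + Real.log b) < (t ^ 9 : ℕ) ∧ (m : ℝ) = (b : ℝ) ^ (7 / 9 : ℝ) := by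
  have ht0 : (0 : ℝ) < t := by positivity
  subst hb hm
  refine ⟨?_, Nat.one_le_pow _ _ (by omega), Nat.pow_le_pow_right (by omega) (by norm_num),
    Nat.one_le_pow _ _ (by omega), by rw [← pow_mul], ?_, ?_⟩
  · calc 4 = 2 ^ 2 := by norm_num
      _ ≤ t ^ 2 := Nat.pow_le_pow_left ht2 2
      _ ≤ t ^ 36 := Nat.pow_le_pow_right (by omega) (by norm_num)
  · push_cast
    rw [Real.log_pow, show (t : ℝ) ^ 36 / (t : ℝ) ^ 28 = (t : ℝ) ^ 8 by field_simp, pow_succ _ 8]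
    push_cast
    gcongr
  · push_cast
    rw [← Real.rpow_natCast, ← Real.rpow_natCast, ← Real.rpow_mul ht0.le]
    norm_num

lemma t_bound (t : ℕ) (h : t = 10 ^ 250) : 2 ≤ t ∧ 3 + 36 * Real.log t < t := by
  subst h
  have h6 : (10 : ℕ) ^ 6 ≤ 10 ^ 250 := Nat.pow_le_pow_right (by norm_num) (by norm_num)
  refine ⟨le_trans (by norm_num) h6, ?_⟩
  have h6' : ((10 : ℝ)) ^ 6 ≤ ((10 ^ 250 : ℕ) : ℝ) := by exact_mod_cast h6
  refine lt_of_lt_of_le ?_ h6'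
  rw [Nat.cast_pow, Real.log_pow]
  have : Real.log ((10 : ℕ) : ℝ) ≤ 10 - 1 := by
    have := Real.log_le_sub_one_of_pos (by norm_num : (0 : ℝ) < ((10 : ℕ) : ℝ))
    refine this.trans (by norm_num)
  push_cast at this ⊢
  linarith

lemma final_aux (b m t : ℕ) (ht : t = 10 ^ 250) (hb : b = t ^ 36) (hm : m = t ^ 28)
    (K : Set (EuclideanSpace ℝ (Fin 2)))
    (hK : K = {v | v 0 ∈ MDset b m ∧ v 1 ∈ MDset b m})
    (z : EuclideanSpace ℝ (Fin 2)) (r : ℝ) (hr : 0 < r) :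
    (∃ C : ℝ, 0 < C ∧ ∀ δ : ℝ, 0 < δ → δ < 1 →
      ∃ S : Finset (EuclideanSpace ℝ (Fin 2)),
        (S.card : ℝ) ≤ C * δ ^ (-(5 / 9 : ℝ)) ∧
        Metric.cthickening δ (Metric.sphere z r) ∩ K ⊆
          ⋃ x ∈ S, Metric.closedBall x δ) ∧
    upperBoxDim (Metric.sphere z r ∩ K) ≤ 5 / 9 := by
  obtain ⟨h1, h2⟩ := t_bound t ht
  obtain ⟨a1, a2, a3, a4, a5, a6, a7⟩ := params t h1 h2 b m hb hm
  have main := main_cover b m (t ^ 9) a1 a2 a3 a4 a5 a6 a7 z r hr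
  rw [← hK] at main
  refine ⟨main, ?_⟩
  obtain ⟨C, hC, h⟩ := main
  refine boxDim_le _ C hC fun δ h0 h1 => ?_
  obtain ⟨S, hS, hS2⟩ := h δ h0 h1
  exact ⟨S, hS, (Set.inter_subset_inter_left K (Metric.self_subset_cthickening _)).trans hS2⟩

/-- with `K = K₂ × K₂` (base `10^9000`, digits `0,…,10^7000 - 1`), for every
circle `S` of centre `z` and radius `r > 0` there is `C > 0` such that for every
`δ ∈ (0,1)` the set `S^δ ∩ K` can be covered by `C δ^{-5/9}` closed `δ`-balls; in
particular the upper box dimension of `S ∩ K` is at most `5/9`. -/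
theorem statement16 (K : Set (EuclideanSpace ℝ (Fin 2)))
    (hK : K = {v | v 0 ∈ MDset (10 ^ 9000) (10 ^ 7000) ∧ v 1 ∈ MDset (10 ^ 9000) (10 ^ 7000)})
    (z : EuclideanSpace ℝ (Fin 2)) (r : ℝ) (hr : 0 < r) :
    (∃ C : ℝ, 0 < C ∧ ∀ δ : ℝ, 0 < δ → δ < 1 →
      ∃ S : Finset (EuclideanSpace ℝ (Fin 2)),
        (S.card : ℝ) ≤ C * δ ^ (-(5 / 9 : ℝ)) ∧
        Metric.cthickening δ (Metric.sphere z r) ∩ K ⊆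
          ⋃ x ∈ S, Metric.closedBall x δ) ∧
    upperBoxDim (Metric.sphere z r ∩ K) ≤ 5 / 9 := by
  exact final_aux (10 ^ 9000) (10 ^ 7000) (10 ^ 250) rfl (pow_mul 10 250 36) (pow_mul 10 250 28)
    K hK z r hr
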